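/- Let T be a tableau of length l, and for each k ∈ [l] let B_k be the end-box of the k-set of T. Then T is a ψ-tableau if and only if for each k ∈ [l], the k-set of T equals the B_k-strip in T^(k). -/

import Mathlib

/-!
Common definitions for formalizing "A recursion on maximal chains in the Tamari lattices"
(L. Nelson).

* Young diagrams are encoded by their row-length functions `lam : ℕ → ℕ` (rows indexed from 1,
  with `lam 0 = 0`).
* Dyck paths are lists of steps (north/east).
* Tableaux are encoded by entry functions `f : ℕ × ℕ → ℕ` (1-indexed boxes; value `0` means
  "no box").  The label of box `(x, y)` is `f (x, y)`.
-/

noncomputable section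

namespace TamariMaxChains

/-- A step of a lattice path: north or east. -/
inductive Step : Type
  | N : Step
  | E : Step
deriving DecidableEq

/-- Number of north steps of a path. -/
def nCount (p : List Step) : ℕ := p.count Step.N

/-- Number of east steps of a path. -/
def eCount (p : List Step) : ℕ := p.count Step.E

/-- `p` is a Dyck path: equally many norths and easts, and every prefix has at least as many
north steps as east steps (the path never goes below the diagonal `y = x`). -/
def IsDyck (p : List Step) : Prop :=
  nCount p = eCount p ∧ ∀ q : List Step, q <+: p → eCount q ≤ nCount q

/-- `q` is a prime Dyck path: it meets the slope-one line joining its endpoints only at its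
endpoints. -/
def IsPrimeDyck (q : List Step) : Prop :=
  q ≠ [] ∧ nCount q = eCount q ∧
    ∀ s : List Step, s <+: q → s ≠ [] → s ≠ q → eCount s < nCount s

/-- Covering relation of the Tamari lattice on Dyck paths:  `TamariCoverD P' P` means `P'`
covers `P`, i.e. `P'` is obtained from `P` by swapping an east step that is followed by a north
step with the prime Dyck subpath following it. -/
def TamariCoverD (P' P : List Step) : Prop :=
  ∃ a q b : List Step, IsPrimeDyck q ∧
    P = a ++ Step.E :: (q ++ b) ∧ P' = a ++ (q ++ Step.E :: b)

/-- `lam` is the row-length function of a Young diagram: rows are indexed from `1`,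
`lam x` is the number of boxes in row `x`, rows weakly decrease, finitely many boxes. -/
def IsDiagram (lam : ℕ → ℕ) : Prop :=
  lam 0 = 0 ∧ (∀ x, 1 ≤ x → lam (x + 1) ≤ lam x) ∧ ∃ N, ∀ x, N ≤ x → lam x = 0

/-- The height (number of north steps) of the prime path of row `d ≥ 1` of the Young diagram
with row lengths `lam`:  the least `t ≥ 1` such that either `t = d` (row `0` being regarded as
an infinite row of boxes) or row `d - t` has length at least `lam d + t`. -/
def primeHeight (lam : ℕ → ℕ) (d : ℕ) : ℕ :=
  sInf {t | 1 ≤ t ∧ (t = d ∨ (t < d ∧ lam d + t ≤ lam (d - t)))}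

/-- The last box of row `d` is a corner box (last box of its row and lowest box of
its column). -/
def IsCorner (lam : ℕ → ℕ) (d : ℕ) : Prop := 1 ≤ d ∧ 1 ≤ lam d ∧ lam (d + 1) < lam d

/-- The result of removing the `B`-strip of the last box `B` of row `d`: the last box of each of
the rows `d - h + 1, …, d` is removed, where `h` is the height of the prime path of row `d`. -/
def removeStrip (lam : ℕ → ℕ) (d : ℕ) : ℕ → ℕ := fun x =>
  if d + 1 ≤ x + primeHeight lam d ∧ x ≤ d then lam x - 1 else lam x

/-- Covering relation of the Tamari lattice on Young diagrams:  `mu` covers `lam` iff `mu` is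
obtained from `lam` by removing the `B`-strip of a corner box `B`. -/
def TamariCoverY (mu lam : ℕ → ℕ) : Prop := ∃ d, IsCorner lam d ∧ mu = removeStrip lam d

/-- The `B`-strip of the last box `B` of row `d`: the set of last boxes of rows
`d - h + 1, …, d`, where `h` is the height of the prime path of row `d`. -/
def stripSet (lam : ℕ → ℕ) (d : ℕ) : Set (ℕ × ℕ) :=
  {b | b.2 = lam b.1 ∧ 1 ≤ b.2 ∧ d + 1 ≤ b.1 + primeHeight lam d ∧ b.1 ≤ d}

/-- The enclosure of the `B`-strip of the last box `B = (d, lam d)` of row `d`: all boxes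
`(x, y)` with `d - h ≤ x ≤ d` and `lam d ≤ y ≤ lam d + h`, where row `0` is regarded as an
infinite row of boxes. -/
def enclosure (lam : ℕ → ℕ) (d : ℕ) : Set (ℕ × ℕ) :=
  {b | (b.1 = 0 ∨ b.2 ≤ lam b.1) ∧ 1 ≤ b.2 ∧
    d ≤ b.1 + primeHeight lam d ∧ b.1 ≤ d ∧ lam d ≤ b.2 ∧ b.2 ≤ lam d + primeHeight lam d}

/-- The Dyck path of length `2 n` corresponding to the Young diagram `lam` contained in the
staircase `δ_{n-1}` (the Dyck path is the silhouette of the Young diagram). -/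
def toDyck (n : ℕ) (lam : ℕ → ℕ) : List Step :=
  ((List.range n).flatMap fun k =>
    List.replicate (lam (n - k) - lam (n - k + 1)) Step.E ++ [Step.N]) ++
    List.replicate (n - lam 1) Step.E

/-- The prime path of row `d` of the Young diagram `lam`, as its list of steps (read from its
lower-left endpoint). -/
def primePathList (lam : ℕ → ℕ) (d : ℕ) : List Step :=
  Step.N :: ((((List.range (primeHeight lam d - 1)).flatMap fun j =>
    List.replicate (lam (d - 1 - j) - lam (d - j)) Step.E ++ [Step.N])) ++
    List.replicate (lam d + primeHeight lam d - lam (d - (primeHeight lam d - 1))) Step.E)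

/-- `S` translates to `S'` by `p` units down and `q` units to the right. -/
def TranslatesBy (p q : ℤ) (S S' : Set (ℕ × ℕ)) : Prop :=
  ∀ x y : ℕ, (x, y) ∈ S' ↔ ∃ a b : ℕ, (a, b) ∈ S ∧ (x : ℤ) = a + p ∧ (y : ℤ) = b + q

/-- `S` translates to `S'`. -/
def Translates (S S' : Set (ℕ × ℕ)) : Prop := ∃ p q : ℤ, TranslatesBy p q S S'

/-- The length of a tableau: its number of distinct labels (for an honest tableau, labels are
exactly `1, …, tlen f`). -/
def tlen (f : ℕ × ℕ → ℕ) : ℕ := sSup {v | v ≠ 0 ∧ ∃ b, f b = v}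

/-- The number of boxes in row `x` of a tableau. -/
def rowLen (f : ℕ × ℕ → ℕ) (x : ℕ) : ℕ := sSup {y | f (x, y) ≠ 0}

/-- The number of boxes in column `y` of a tableau. -/
def colLen (f : ℕ × ℕ → ℕ) (y : ℕ) : ℕ := sSup {x | f (x, y) ≠ 0}

/-- `f` is (the entry function of) a tableau: the support is a Young diagram (1-indexed),
rows strictly increase, columns weakly increase, and the set of labels is exactly
`{1, …, tlen f}`. -/
def IsTableau (f : ℕ × ℕ → ℕ) : Prop :=
  (∀ y, f (0, y) = 0) ∧ (∀ x, f (x, 0) = 0) ∧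
  {b : ℕ × ℕ | f b ≠ 0}.Finite ∧
  (∀ x y x' y', 1 ≤ x' → x' ≤ x → 1 ≤ y' → y' ≤ y → f (x, y) ≠ 0 → f (x', y') ≠ 0) ∧
  (∀ x y, f (x, y) ≠ 0 → f (x, y + 1) ≠ 0 → f (x, y) < f (x, y + 1)) ∧
  (∀ x y, f (x, y) ≠ 0 → f (x + 1, y) ≠ 0 → f (x, y) ≤ f (x + 1, y)) ∧
  (∀ v, 1 ≤ v → (v ≤ tlen f ↔ ∃ b, f b = v))

/-- `T^(r)`: the subtableau of all entries at most `r`. -/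
def trunc (f : ℕ × ℕ → ℕ) (r : ℕ) : ℕ × ℕ → ℕ := fun b => if f b ≤ r then f b else 0

/-- The shape (row-length function) of a tableau. -/
def shapeOf (f : ℕ × ℕ → ℕ) : ℕ → ℕ := fun x => rowLen f x

/-- The row index of the end-box of the `k`-set of `f` (the maximal row index of a box
labeled `k`). -/
def endRow (f : ℕ × ℕ → ℕ) (k : ℕ) : ℕ := sSup {x | ∃ y, f (x, y) = k}

/-- `Y 0 ⋗ Y 1 ⋗ ⋯ ⋗ Y l` is a saturated chain in the Tamari order on Young diagrams whose
maximal element `Y 0` is the empty diagram (each `Y r` covers `Y (r+1)`). -/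
def IsTamariChain (Y : ℕ → ℕ → ℕ) (l : ℕ) : Prop :=
  (∀ r, r ≤ l → IsDiagram (Y r)) ∧ (∀ x, Y 0 x = 0) ∧
    ∀ r, r < l → TamariCoverY (Y r) (Y (r + 1))

/-- The tableau `ψ(C)` of the saturated chain `C = (∅ = Y 0 ⋗ ⋯ ⋗ Y l)`: the boxes removed in
the transition `Y (r-1) ⋗ Y r` are labeled `r`; that is, each box of `Y l` is labeled by the
least `r` such that the box belongs to `Y r`. -/
def psiFun (Y : ℕ → ℕ → ℕ) (l : ℕ) : ℕ × ℕ → ℕ := fun b =>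
  if 1 ≤ b.1 ∧ 1 ≤ b.2 ∧ b.2 ≤ Y l b.1 then sInf {r | r ≤ l ∧ b.2 ≤ Y r b.1} else 0

/-- `f` is a `ψ`-tableau: it is in the image of `ψ`. -/
def IsPsiTab (f : ℕ × ℕ → ℕ) : Prop :=
  ∃ l Y, IsTamariChain Y l ∧ f = psiFun Y l

/-- Row lengths of the staircase shape `δ_{n-1} = (n-1, n-2, …, 1)`: row `x ≥ 1` has `n - x`
boxes. -/
def dstair (n : ℕ) : ℕ → ℕ := fun x => if x = 0 then 0 else n - x

/-- `C_i(n)`, via `ψ`: the set of maximal chains of length `n + i` in the Tamari lattice `T_n`,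
identified with the `ψ`-tableaux of length `n + i` and shape `δ_{n-1}`. -/
def MemC (i : ℤ) (n : ℕ) (f : ℕ × ℕ → ℕ) : Prop :=
  IsTableau f ∧ IsPsiTab f ∧ (∀ x, rowLen f x = dstair n x) ∧ (tlen f : ℤ) = (n : ℤ) + i

/-- The `r`-set of `f` (of shape `δ_{n-1}`) is a full-set with end-box `(k, n - k)`:
it begins in row `1` and ends in the outer diagonal, at the box `(k, n - k)`. -/
def HasFullSetAt (f : ℕ × ℕ → ℕ) (n r k : ℕ) : Prop :=
  (∃ y, f (1, y) = r) ∧ 1 ≤ k ∧ k ≤ n - 1 ∧ f (k, n - k) = r ∧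
    ∀ x y, f (x, y) = r → x ≤ k

/-- `f` has an `r`-full-set. -/
def HasFullSet (f : ℕ × ℕ → ℕ) (n r : ℕ) : Prop := ∃ k, HasFullSetAt f n r k

/-- `f` has an `r⁺`-full-set (plus-full-set): an `r`-full-set whose end-box `(k, n-k)` satisfies
`k = n - 1`, or `k ≤ n - 2` and the southwest neighbor has a smaller label. -/
def HasPlusFullSet (f : ℕ × ℕ → ℕ) (n r : ℕ) : Prop :=
  ∃ k, HasFullSetAt f n r k ∧ (k = n - 1 ∨ (k ≤ n - 2 ∧ f (k + 1, n - k - 1) < r))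

/-- `F_i^r(n)`: the set of `C ∈ C_i(n)` whose `r`-set is a plus-full-set and whose `j`-set is
not a plus-full-set for any `j ∈ [r-1]`. -/
def MemF (i : ℤ) (n : ℕ) (r : ℕ) (f : ℕ × ℕ → ℕ) : Prop :=
  MemC i n f ∧ HasPlusFullSet f n r ∧ ∀ j, 1 ≤ j → j < r → ¬ HasPlusFullSet f n j

/-- `N_i(n)`: the set of `C ∈ C_i(n)` having no plus-full-sets. -/
def MemN (i : ℤ) (n : ℕ) (f : ℕ × ℕ → ℕ) : Prop :=
  MemC i n f ∧ ∀ r, ¬ HasPlusFullSet f n r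

/-- `α_d`: shift all rows of index greater than `d` down one row and repeat row `d` in
row `d + 1`. -/
def alphaFun (d : ℕ) (f : ℕ × ℕ → ℕ) : ℕ × ℕ → ℕ := fun b =>
  if b.1 ≤ d then f b else f (b.1 - 1, b.2)

/-- `β_d`: append a box labeled `tlen f + 1` at the end of each of the rows `1, …, d`. -/
def betaFun (d : ℕ) (f : ℕ × ℕ → ℕ) : ℕ × ℕ → ℕ := fun b =>
  if 1 ≤ b.1 ∧ b.1 ≤ d ∧ b.2 = rowLen f b.1 + 1 then tlen f + 1 else f b

/-- The number of boxes of row `x` of `f` whose label is at most `r` (these occupy an initial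
segment of the row). -/
def lowLen (f : ℕ × ℕ → ℕ) (r x : ℕ) : ℕ := sSup {y | f (x, y) ≠ 0 ∧ f (x, y) ≤ r}

/-- The row index `d` used in the definition of `Ĉ(r)`: the minimal `k ∈ [n-1]` with
`C (k, n-k) ≤ r` if such `k` exists, and `n` otherwise. -/
def hatD (f : ℕ × ℕ → ℕ) (n r : ℕ) : ℕ :=
  sInf ({k | 1 ≤ k ∧ k ≤ n - 1 ∧ 1 ≤ f (k, n - k) ∧ f (k, n - k) ≤ r} ∪ {n})

/-- `Ĉ(r)` for `C ∈ C_i(n)` and `0 ≤ r ≤ n + i`: starting from `β_d(α_d(C^(r)))` (where `d` is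
as in `hatD`), the entries of `C` greater than `r` of row index less than `d` are translated one
unit to the right, those of row index greater than `d` are translated one unit down, and all
these labels are incremented by one. -/
def hatFun (f : ℕ × ℕ → ℕ) (n r : ℕ) : ℕ × ℕ → ℕ := fun b =>
  let d := hatD f n r
  let x := b.1
  let y := b.2
  if x = 0 ∨ y = 0 then 0
  else if x ≤ d then
    if f (x, y) ≠ 0 ∧ f (x, y) ≤ r then f (x, y)
    else if y = lowLen f r x + 1 then r + 1
    else if r < f (x, y - 1) then f (x, y - 1) + 1
    else 0
  else if x = d + 1 then f (d, y)
  else if f (x - 1, y) = 0 then 0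
  else if f (x - 1, y) ≤ r then f (x - 1, y)
  else f (x - 1, y) + 1

/-- `RepBy i m t r C0 C` : `C = (φ_{i,m+t-1}^{r 1} ∘ φ_{i,m+t-2}^{r 2} ∘ ⋯ ∘ φ_{i,m}^{r t}) C0`,
each factor being applied within its domain. -/
def RepBy (i : ℤ) (m t : ℕ) (r : ℕ → ℕ) (C0 C : ℕ × ℕ → ℕ) : Prop :=
  ∃ D : ℕ → ℕ × ℕ → ℕ, D 0 = C0 ∧ D t = C ∧
    ∀ s, s < t →
      MemC i (m + s) (D s) ∧
      ((r (t - s) : ℤ) ≤ (m : ℤ) + s + i) ∧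
      (∀ j, 1 ≤ j → j ≤ r (t - s) → ¬ HasPlusFullSet (D s) (m + s) j) ∧
      D (s + 1) = hatFun (D s) (m + s) (r (t - s))

/-- The set `𝕏_{d,n-1}^r` of Theorem 4.3: `ψ`-tableaux of length `r`, contained in `δ_{n-1}`,
whose row `d` has length `n - d` and whose prime path of row `d` has height `d`. -/
def MemX (d n r : ℕ) (f : ℕ × ℕ → ℕ) : Prop :=
  IsTableau f ∧ IsPsiTab f ∧ tlen f = r ∧
    (∀ x, 1 ≤ x → rowLen f x ≤ n - x) ∧
    rowLen f d = n - d ∧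
    primeHeight (shapeOf f) d = d

/-- The set `ℤ_{d,n}^{r+1}` of Theorem 4.3: `ψ`-tableaux of length `r + 1`, contained in `δ_n`,
such that rows `d` and `d+1` of the truncation at `r` are identical, the end-box of the
`(r+1)`-set is `(d, n-d+1)`, and the prime path of `(d, n-d+1)` has height `d`. -/
def MemZ (d n r : ℕ) (g : ℕ × ℕ → ℕ) : Prop :=
  IsTableau g ∧ IsPsiTab g ∧ tlen g = r + 1 ∧
    (∀ x, 1 ≤ x → rowLen g x ≤ n + 1 - x) ∧
    (∀ y, trunc g r (d, y) = trunc g r (d + 1, y)) ∧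
    g (d, n - d + 1) = r + 1 ∧ (∀ x y, g (x, y) = r + 1 → x ≤ d) ∧
    primeHeight (shapeOf g) d = d

lemma le_sSup_iff_mem (S : Set ℕ) (hb : BddAbove S)
    (hd : ∀ a b, 1 ≤ a → a ≤ b → b ∈ S → a ∈ S) (y : ℕ) (hy : 1 ≤ y) :
    y ≤ sSup S ↔ y ∈ S := by
  constructor
  · intro h
    have hne : S.Nonempty := by
      by_contra hne
      rw [Set.not_nonempty_iff_eq_empty] at hne
      rw [hne] at h
      simp at h
      omega
    exact hd y _ hy h (Nat.sSup_mem hne hb)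
  · intro h
    exact le_csSup hb h

lemma row_mono (f : ℕ × ℕ → ℕ) (hf : IsTableau f) (x a : ℕ) (ha : 1 ≤ a) (t : ℕ)
    (h : f (x, a + t) ≠ 0) : f (x, a) + t ≤ f (x, a + t) := by
  obtain ⟨h1, -, -, h4, h5, -, -⟩ := hf
  have hx : 1 ≤ x := by
    by_contra hx
    have : x = 0 := by omega
    subst this
    exact h (h1 _)
  induction t with
  | zero => simp
  | succ t ih =>
    have h' : f (x, a + t) ≠ 0 := h4 x (a + (t + 1)) x (a + t) hx le_rfl (by omega) (by omega) h
    have := h5 x (a + t) h' h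
    have := ih h'
    rw [show a + (t + 1) = a + t + 1 by ring]
    omega

lemma low_iff (f : ℕ × ℕ → ℕ) (hf : IsTableau f) (k x y : ℕ) (hy : 1 ≤ y) :
    y ≤ shapeOf (trunc f k) x ↔ 1 ≤ f (x, y) ∧ f (x, y) ≤ k := by
  have hfin := hf.2.2.1
  have h1 := hf.1
  have h4 := hf.2.2.2.1
  unfold shapeOf rowLen
  rw [le_sSup_iff_mem _ _ _ y hy]
  · simp only [trunc, Set.mem_setOf_eq]
    split_ifs <;> omega
  · obtain ⟨M, hM⟩ := (hfin.image Prod.snd).bddAbove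
    refine ⟨M, fun z hz => hM ⟨(x, z), ?_, rfl⟩⟩
    simp only [trunc, Set.mem_setOf_eq] at hz ⊢
    split_ifs at hz <;> omega
  · intro a b ha hab hb
    obtain ⟨t, rfl⟩ := Nat.exists_eq_add_of_le hab
    simp only [trunc, Set.mem_setOf_eq] at hb ⊢
    split_ifs at hb with hle
    · have hx : 1 ≤ x := by
        by_contra hx
        have : x = 0 := by omega
        subst this
        exact hb (h1 _)
      have := row_mono f hf x a ha t hb
      have h0 := h4 x (a + t) x a hx le_rfl ha hab hb
      rw [if_pos (by omega)]
      exact h0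
    · omega

lemma primeHeight_pos (lam : ℕ → ℕ) (d : ℕ) (hd : 1 ≤ d) :
    1 ≤ primeHeight lam d :=
  (Nat.sInf_mem (s := {t | 1 ≤ t ∧ (t = d ∨ (t < d ∧ lam d + t ≤ lam (d - t)))})
    ⟨d, hd, Or.inl rfl⟩).1

lemma label_le_tlen (f : ℕ × ℕ → ℕ) (hf : IsTableau f) (b : ℕ × ℕ) : f b ≤ tlen f := by
  by_cases h : 1 ≤ f b
  · exact (hf.2.2.2.2.2.2 (f b) h).2 ⟨b, rfl⟩
  · omega

lemma pos_of_ne (f : ℕ × ℕ → ℕ) (hf : IsTableau f) (x y : ℕ) (h : f (x, y) ≠ 0) :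
    1 ≤ x ∧ 1 ≤ y := by
  constructor
  · by_contra hx
    have : x = 0 := by omega
    subst this
    exact h (hf.1 _)
  · by_contra hx
    have : y = 0 := by omega
    subst this
    exact h (hf.2.1 _)

lemma eq_of_pos_le_iff (a b : ℕ) (h : ∀ y, 1 ≤ y → (y ≤ a ↔ y ≤ b)) : a = b := by
  have h1 := h a
  have h2 := h b
  omega

lemma endRow_spec (f : ℕ × ℕ → ℕ) (hf : IsTableau f) (k : ℕ) (hk : 1 ≤ k) (hl : k ≤ tlen f) :
    (∃ y, f (endRow f k, y) = k) ∧ ∀ x y, f (x, y) = k → x ≤ endRow f k := by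
  have hb : BddAbove {x | ∃ y, f (x, y) = k} := by
    obtain ⟨M, hM⟩ := (hf.2.2.1.image Prod.fst).bddAbove
    refine ⟨M, ?_⟩
    rintro z ⟨y, hz⟩
    refine hM ⟨(z, y), ?_, rfl⟩
    simp only [Set.mem_setOf_eq]
    omega
  obtain ⟨⟨x, y⟩, hxy⟩ := (hf.2.2.2.2.2.2 k hk).1 hl
  constructor
  · exact Nat.sSup_mem (s := {x | ∃ y, f (x, y) = k}) ⟨x, y, hxy⟩ hb
  · intro x y h
    exact le_csSup hb ⟨y, h⟩

lemma shape_diagram (f : ℕ × ℕ → ℕ) (hf : IsTableau f) (k : ℕ) :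
    IsDiagram (shapeOf (trunc f k)) := by
  refine ⟨?_, ?_, ?_⟩
  · by_contra h
    have := (low_iff f hf k 0 1 le_rfl).1 (by omega)
    rw [hf.1] at this
    omega
  · intro x hx
    by_contra h
    have h1 := (low_iff f hf k (x + 1) (shapeOf (trunc f k) (x + 1)) (by omega)).1 le_rfl
    have h2 := hf.2.2.2.1 (x + 1) (shapeOf (trunc f k) (x + 1)) x (shapeOf (trunc f k) (x + 1))
      hx (by omega) (by omega) le_rfl (by omega)
    have h3 := hf.2.2.2.2.2.1 x _ h2 (by omega)
    have := (low_iff f hf k x (shapeOf (trunc f k) (x + 1)) (by omega)).2 (by omega)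
    omega
  · obtain ⟨M, hM⟩ := (hf.2.2.1.image Prod.fst).bddAbove
    refine ⟨M + 1, fun x hx => ?_⟩
    by_contra h
    have h1 := (low_iff f hf k x 1 le_rfl).1 (by omega)
    have : x ≤ M := hM ⟨(x, 1), by simp only [Set.mem_setOf_eq]; omega, rfl⟩
    omega

lemma cover_of_strip (f : ℕ × ℕ → ℕ) (hf : IsTableau f) (r : ℕ) (hr : r + 1 ≤ tlen f)
    (h : {b : ℕ × ℕ | f b = r + 1} =
      stripSet (shapeOf (trunc f (r + 1))) (endRow f (r + 1))) :
    TamariCoverY (shapeOf (trunc f r)) (shapeOf (trunc f (r + 1))) := by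
  obtain ⟨⟨y, hy⟩, hmax⟩ := endRow_spec f hf (r + 1) (by omega) hr
  set d := endRow f (r + 1) with hd
  have hset : ∀ x y, f (x, y) = r + 1 ↔ (x, y) ∈ stripSet (shapeOf (trunc f (r + 1))) d := by
    intro x y
    rw [← h]
    rfl
  obtain ⟨hd1, hy1⟩ := pos_of_ne f hf d y (by omega)
  have hyl := (low_iff f hf (r + 1) d y hy1).2 (by omega)
  refine ⟨d, ⟨hd1, by omega, ?_⟩, ?_⟩
  · by_contra hc
    have h1 := (low_iff f hf (r + 1) (d + 1) y hy1).1 (by omega)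
    have h2 := hf.2.2.2.2.2.1 d y (by omega) (by omega)
    have := hmax (d + 1) y (by omega)
    omega
  · funext x
    apply eq_of_pos_le_iff
    intro z hz
    rw [low_iff f hf r x z hz]
    have hL := low_iff f hf (r + 1) x z hz
    have hS := hset x z
    simp only [stripSet, Set.mem_setOf_eq] at hS
    unfold removeStrip
    by_cases hc : d + 1 ≤ x + primeHeight (shapeOf (trunc f (r + 1))) d ∧ x ≤ d
    · rw [if_pos hc]
      omega
    · rw [if_neg hc]
      omega

lemma chain_mono (Y : ℕ → ℕ → ℕ) (l : ℕ) (hY : IsTamariChain Y l) (x a t : ℕ) (h : a + t ≤ l) :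
    Y a x ≤ Y (a + t) x := by
  induction t with
  | zero => simp
  | succ t ih =>
    have h1 := ih (by omega)
    obtain ⟨d, -, h2⟩ := hY.2.2 (a + t) (by omega)
    refine h1.trans ?_
    rw [h2]
    unfold removeStrip
    rw [show a + (t + 1) = a + t + 1 by ring]
    split_ifs <;> omega

lemma psi_iff (Y : ℕ → ℕ → ℕ) (l : ℕ) (hY : IsTamariChain Y l) (k x y : ℕ) (hk : k ≤ l)
    (hy : 1 ≤ y) :
    (1 ≤ psiFun Y l (x, y) ∧ psiFun Y l (x, y) ≤ k) ↔ y ≤ Y k x := by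
  have hkl : Y k x ≤ Y l x := by
    obtain ⟨t, rfl⟩ := Nat.exists_eq_add_of_le hk
    exact chain_mono Y _ hY x k t le_rfl
  have h0 := (hY.1 k hk).1
  unfold psiFun
  simp only
  split_ifs with hc
  · have hmem := Nat.sInf_mem (s := {r | r ≤ l ∧ y ≤ Y r x}) ⟨l, le_rfl, hc.2.2⟩
    set s := sInf {r | r ≤ l ∧ y ≤ Y r x} with hs
    obtain ⟨hsl, hsy⟩ := hmem
    constructor
    · rintro ⟨-, hsk⟩
      obtain ⟨t, rfl⟩ := Nat.exists_eq_add_of_le hsk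
      exact hsy.trans (chain_mono Y _ hY x s t hk)
    · intro h
      refine ⟨?_, Nat.sInf_le ⟨hk, h⟩⟩
      by_contra hs0
      have : s = 0 := by omega
      rw [this, hY.2.1] at hsy
      omega
  · constructor
    · omega
    · intro h
      exfalso
      apply hc
      refine ⟨?_, hy, by omega⟩
      by_contra hx
      have : x = 0 := by omega
      subst this
      omega

lemma psi_strip (f : ℕ × ℕ → ℕ) (hf : IsTableau f) (Y : ℕ → ℕ → ℕ) (l : ℕ)
    (hY : IsTamariChain Y l) (hfY : f = psiFun Y l) (k : ℕ) (hk : 1 ≤ k) (hkt : k ≤ tlen f) :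
    {b : ℕ × ℕ | f b = k} = stripSet (shapeOf (trunc f k)) (endRow f k) := by
  have hkl : k ≤ l := by
    obtain ⟨⟨x, y⟩, hxy⟩ := (hf.2.2.2.2.2.2 k hk).1 hkt
    obtain ⟨hx, hy⟩ := pos_of_ne f hf x y (by omega)
    have hne : psiFun Y l (x, y) = k := by rw [← hfY]; exact hxy
    have hc : y ≤ Y l x := by
      by_contra hc
      unfold psiFun at hne
      simp only at hne
      rw [if_neg (by omega)] at hne
      omega
    have := (psi_iff Y l hY l x y le_rfl hy).2 hc
    omega
  have hL : shapeOf (trunc f k) = Y k := by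
    funext x
    apply eq_of_pos_le_iff
    intro z hz
    rw [low_iff f hf k x z hz, ← psi_iff Y l hY k x z hkl hz, hfY]
  rw [hL]
  obtain ⟨r, rfl⟩ := Nat.exists_eq_add_of_le' hk
  obtain ⟨d, hcor, hrem⟩ := hY.2.2 r (by omega)
  have hset : {b : ℕ × ℕ | f b = r + 1} = stripSet (Y (r + 1)) d := by
    ext ⟨x, y⟩
    by_cases hy : 1 ≤ y
    · have h1 := psi_iff Y l hY (r + 1) x y hkl hy
      have h2 := psi_iff Y l hY r x y (by omega) hy
      rw [hrem] at h2
      rw [← hfY] at h1 h2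
      simp only [stripSet, Set.mem_setOf_eq]
      unfold removeStrip at h2
      split_ifs at h2 <;> omega
    · have : y = 0 := by omega
      subst this
      simp only [stripSet, Set.mem_setOf_eq, hf.2.1]
      omega
  have hend : endRow f (r + 1) = d := by
    obtain ⟨⟨y, hy⟩, hmax⟩ := endRow_spec f hf (r + 1) hk hkt
    apply le_antisymm
    · have : (endRow f (r + 1), y) ∈ stripSet (Y (r + 1)) d := by
        rw [← hset]
        exact hy
      exact this.2.2.2
    · apply hmax d (Y (r + 1) d)
      have : (d, Y (r + 1) d) ∈ {b : ℕ × ℕ | f b = r + 1} := by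
        rw [hset]
        have := primeHeight_pos (Y (r + 1)) d hcor.1
        refine ⟨rfl, hcor.2.1, ?_, le_rfl⟩
        simp only
        omega
      exact this
  rw [hset, hend]

/-- **Proposition 3.4(1) (characterization of `ψ`-tableaux).**  Let `T` be a tableau of length
`l`, and for `k ∈ [l]` let `B_k` be the end-box of the `k`-set.  Then `T` is a `ψ`-tableau if
and only if for each `k ∈ [l]`, the `k`-set is the `B_k`-strip in `T^(k)`. -/
theorem psi_tableau_characterization (f : ℕ × ℕ → ℕ) (hf : IsTableau f) :
    IsPsiTab f ↔ ∀ k, 1 ≤ k → k ≤ tlen f →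
      {b : ℕ × ℕ | f b = k} = stripSet (shapeOf (trunc f k)) (endRow f k) := by
  constructor
  · rintro ⟨l, Y, hY, hfY⟩ k hk hkt
    exact psi_strip f hf Y l hY hfY k hk hkt
  · intro h
    have hchain : IsTamariChain (fun r => shapeOf (trunc f r)) (tlen f) := by
      refine ⟨fun r _ => shape_diagram f hf r, fun x => ?_, fun r hr => ?_⟩
      · by_contra hne
        have := (low_iff f hf 0 x 1 le_rfl).1 (Nat.one_le_iff_ne_zero.2 hne)
        omega
      · exact cover_of_strip f hf r (by omega) (h (r + 1) (by omega) (by omega))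
    refine ⟨tlen f, fun r => shapeOf (trunc f r), hchain, ?_⟩
    funext ⟨x, y⟩
    by_cases hy : 1 ≤ y
    · have key : ∀ k, k ≤ tlen f → ((1 ≤ psiFun (fun r => shapeOf (trunc f r)) (tlen f) (x, y) ∧
          psiFun (fun r => shapeOf (trunc f r)) (tlen f) (x, y) ≤ k) ↔
          (1 ≤ f (x, y) ∧ f (x, y) ≤ k)) := fun k hk =>
        (psi_iff _ _ hchain k x y hk hy).trans (low_iff f hf k x y hy)
      have hle := label_le_tlen f hf (x, y)
      have hle2 : psiFun (fun r => shapeOf (trunc f r)) (tlen f) (x, y) ≤ tlen f := by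
        unfold psiFun
        simp only
        split_ifs with hc
        · exact Nat.sInf_le ⟨le_rfl, hc.2.2⟩
        · omega
      have k1 := key _ hle
      have k2 := key _ hle2
      omega
    · have : y = 0 := by omega
      subst this
      rw [hf.2.1]
      simp [psiFun]

end TamariMaxChains
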